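/- Let (X,ℬ,μ,T) be a σ-finite measure preserving system (μ σ-finite, μ∘T^{-1} = μ). If there exists no absolutely continuous T-invariant probability measure, then for every L ∈ ℕ and every choice of sets A_1,…,A_L ∈ ℬ with 0 < μ(A_i) < ∞, there exists a strictly increasing sequence (n_k) of natural numbers such that for all α,β ∈ {1,…,L}, μ(A_α ∩ T^{-(n_j−n_l)}A_β) → 0 as j−l → ∞ (over pairs l < j). -/

import Mathlib

open MeasureTheory Filter
open scoped ENNReal

open scoped Topology in
/-- Cesàro means of a nonnegative sequence tending to zero force arbitrarily late small terms. -/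
lemma exists_gt_lt_of_tendsto_cesaro_zero {c : ℕ → ℝ} (hc : ∀ k, 0 ≤ c k)
    (h : Tendsto (fun N : ℕ ↦ (N : ℝ)⁻¹ * ∑ k ∈ Finset.range N, c k) atTop (𝓝 0))
    {ε : ℝ} (hε : 0 < ε) (m : ℕ) : ∃ n > m, c n < ε := by
  by_contra! H
  have key : ε / 2 ≤ 0 := by
    refine ge_of_tendsto h ?_
    filter_upwards [eventually_ge_atTop (2 * (m + 1))] with N hN
    have hN' : (2 * (m + 1) : ℝ) ≤ N := by exact_mod_cast hN
    have hNpos : (0 : ℝ) < N := by linarith [(Nat.cast_nonneg m : (0 : ℝ) ≤ m)]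
    have h1 : ∑ k ∈ Finset.Ico (m + 1) N, c k ≤ ∑ k ∈ Finset.range N, c k :=
      Finset.sum_le_sum_of_subset_of_nonneg
        (fun k hk ↦ Finset.mem_range.2 (Finset.mem_Ico.1 hk).2) fun k _ _ ↦ hc k
    have h2 : ((N : ℝ) - (m + 1)) * ε ≤ ∑ k ∈ Finset.Ico (m + 1) N, c k := by
      have := Finset.card_nsmul_le_sum (Finset.Ico (m + 1) N) c ε
        fun k hk ↦ H k (Finset.mem_Ico.1 hk).1
      rw [Nat.card_Ico, nsmul_eq_mul, Nat.cast_sub (by lia)] at this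
      exact_mod_cast this
    rw [inv_mul_eq_div, le_div_iff₀ hNpos]
    nlinarith
  linarith

section Koopman

variable {X : Type*} [MeasurableSpace X] {μ : Measure X} {T : X → X}

/-- The normalization of `|g|² μ`, for a nonzero invariant `g` in `L²`, is an invariant
probability measure. -/
lemma exists_acip_of_compMeasurePreserving_eq (hT : MeasurePreserving T μ μ)
    {g : Lp ℝ 2 μ} (hg : Lp.compMeasurePreserving T hT g = g) (hg0 : g ≠ 0) :
    ∃ ν : Measure X, IsProbabilityMeasure ν ∧ ν ≪ μ ∧ ν.map T = ν := by
  set f : X → ℝ≥0∞ := fun x ↦ ‖g x‖ₑ ^ 2 with hf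
  have hfm : Measurable f := (Lp.stronglyMeasurable g).measurable.enorm.pow_const 2
  have hfT : f ∘ T =ᵐ[μ] f := by
    have h := Lp.coeFn_compMeasurePreserving g hT
    rw [hg] at h
    filter_upwards [h] with x hx
    simp [hf, hx]
  have hI0 : ∫⁻ x, f x ∂μ ≠ 0 := by
    intro h0
    rw [lintegral_eq_zero_iff hfm] at h0
    refine hg0 (Lp.eq_zero_iff_ae_eq_zero.2 ?_)
    filter_upwards [h0] with x hx
    simpa [hf] using hx
  have hItop : ∫⁻ x, f x ∂μ ≠ ∞ := by
    have := lintegral_rpow_enorm_lt_top_of_eLpNorm_lt_top (p := 2) (by simp) (by simp)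
      (Lp.eLpNorm_lt_top g)
    simpa [hf] using this.ne
  refine ⟨(∫⁻ x, f x ∂μ)⁻¹ • μ.withDensity f, ⟨?_⟩, ?_, ?_⟩
  · simp [ENNReal.inv_mul_cancel hI0 hItop]
  · exact (withDensity_absolutelyContinuous μ f).smul_left _
  · rw [Measure.map_smul]
    congr 1
    ext s hs
    rw [Measure.map_apply hT.measurable hs, withDensity_apply _ (hT.measurable hs),
      withDensity_apply _ hs, ← hT.setLIntegral_comp_preimage hs hfm]
    exact lintegral_congr_ae (ae_restrict_of_ae hfT.symm)

lemma iterate_compMeasurePreserving_indicatorConstLp (hT : MeasurePreserving T μ μ)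
    {B : Set X} (hB : MeasurableSet B) (hBfin : μ B ≠ ∞) (k : ℕ) :
    (Lp.compMeasurePreserving T hT)^[k] (indicatorConstLp 2 hB hBfin (1 : ℝ)) =
      indicatorConstLp 2 ((hT.iterate k).measurable hB)
        (by rwa [(hT.iterate k).measure_preimage hB.nullMeasurableSet]) (1 : ℝ) := by
  induction k with
  | zero => rfl
  | succ k ih => rw [Function.iterate_succ_apply', ih]; rfl

/-- Without an absolutely continuous invariant probability measure, sets of finite measure are
almost disjoint from some of their arbitrarily late preimages. -/
lemma exists_gt_measureReal_inter_preimage_iterate_lt (hT : MeasurePreserving T μ μ)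
    (hnoacip : ¬ ∃ ν : Measure X, IsProbabilityMeasure ν ∧ ν ≪ μ ∧ ν.map T = ν)
    {B : Set X} (hB : MeasurableSet B) (hBfin : μ B ≠ ∞) {ε : ℝ} (hε : 0 < ε) (m : ℕ) :
    ∃ n > m, μ.real (B ∩ T^[n] ⁻¹' B) < ε := by
  refine exists_gt_lt_of_tendsto_cesaro_zero (fun _ ↦ measureReal_nonneg) ?_ hε m
  let U : Lp ℝ 2 μ →L[ℝ] Lp ℝ 2 μ :=
    (Lp.compMeasurePreservingₗᵢ ℝ T hT).toContinuousLinearMap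
  have hU : ⇑U = Lp.compMeasurePreserving T hT := rfl
  let f : Lp ℝ 2 μ := indicatorConstLp 2 hB hBfin (1 : ℝ)
  have hfix : ∀ g : Lp ℝ 2 μ, U g = g → g = 0 := fun g hg ↦ by
    by_contra hg0
    exact hnoacip (exists_acip_of_compMeasurePreserving_eq hT hg hg0)
  have hlim := U.tendsto_birkhoffAverage_orthogonalProjection
    (LinearIsometry.norm_toContinuousLinearMap_le _) f
  rw [hfix _ ((U.eqLocus (1 : Lp ℝ 2 μ →L[ℝ] Lp ℝ 2 μ)).orthogonalProjectionOnto f).2] at hlim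
  have hinner := (tendsto_const_nhds (x := f)).inner (𝕜 := ℝ) hlim
  rw [inner_zero_right] at hinner
  refine hinner.congr fun N ↦ ?_
  rw [birkhoffAverage, birkhoffSum, inner_smul_right, inner_sum]
  congr 1
  refine Finset.sum_congr rfl fun k _ ↦ ?_
  rw [id, hU, iterate_compMeasurePreserving_indicatorConstLp hT hB hBfin k,
    L2.inner_indicatorConstLp_indicatorConstLp hB ((hT.iterate k).measurable hB) hBfin
      (by rwa [(hT.iterate k).measure_preimage hB.nullMeasurableSet])]
  simp

/-- Simultaneous version along a finite window of shifts. -/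
lemma exists_gt_forall_le_measureReal_lt (hT : MeasurePreserving T μ μ)
    (hnoacip : ¬ ∃ ν : Measure X, IsProbabilityMeasure ν ∧ ν ≪ μ ∧ ν.map T = ν)
    {B : Set X} (hB : MeasurableSet B) (hBfin : μ B ≠ ∞) {ε : ℝ} (hε : 0 < ε) (m : ℕ) :
    ∃ n > m, ∀ l ≤ m, μ.real (B ∩ T^[n - l] ⁻¹' B) < ε := by
  let C : Set X := ⋃ l ∈ Finset.range (m + 1), T^[l] ⁻¹' B
  have hC : MeasurableSet C :=
    Finset.measurableSet_biUnion _ fun l _ ↦ (hT.iterate l).measurable hB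
  have hCfin : μ C ≠ ∞ := by
    refine ((measure_biUnion_finset_le _ _).trans_lt (ENNReal.sum_lt_top.2 fun l _ ↦ ?_)).ne
    rw [(hT.iterate l).measure_preimage hB.nullMeasurableSet]
    exact hBfin.lt_top
  have hsub : ∀ l ≤ m, T^[l] ⁻¹' B ⊆ C := fun l hl ↦
    Set.subset_biUnion_of_mem (u := fun l ↦ T^[l] ⁻¹' B)
      (Finset.mem_coe.2 (Finset.mem_range.2 (by lia)))
  obtain ⟨n, hn, hlt⟩ :=
    exists_gt_measureReal_inter_preimage_iterate_lt hT hnoacip hC hCfin hε m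
  refine ⟨n, hn, fun l hl ↦ lt_of_le_of_lt ?_ hlt⟩
  have hpre : T^[l] ⁻¹' (B ∩ T^[n - l] ⁻¹' B) = T^[l] ⁻¹' B ∩ T^[n] ⁻¹' B := by
    rw [Set.preimage_inter, ← Set.preimage_comp, ← Function.iterate_add,
      Nat.sub_add_cancel (by lia)]
  have hmeas : MeasurableSet (B ∩ T^[n - l] ⁻¹' B) :=
    hB.inter ((hT.iterate _).measurable hB)
  rw [measureReal_def, ← (hT.iterate l).measure_preimage hmeas.nullMeasurableSet, hpre,
    ← measureReal_def]
  refine measureReal_mono (Set.inter_subset_inter (hsub l hl) (Set.preimage_mono ?_))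
    (measure_ne_top_of_subset Set.inter_subset_left hCfin)
  simpa using hsub 0 (Nat.zero_le m)

end Koopman

/-- **Lemma: no a.c.i.p. yields joint sweeping-out times.**
Let `(X, ℬ, μ, T)` be a σ-finite measure preserving system with no absolutely continuous
`T`-invariant probability measure.  Then for every `L` and sets `A_1, …, A_L` of positive
finite measure there is a strictly increasing sequence `(n_k)` such that for all
`α, β ∈ {1,…,L}`, `μ(A_α ∩ T^{-(n_j - n_l)} A_β) → 0` as `j - l → ∞` over pairs `l < j`. -/
theorem stmt_3 {X : Type*} [MeasurableSpace X] (μ : Measure X) [SigmaFinite μ]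
    (T : X → X) (hT : MeasurePreserving T μ μ)
    (hnoacip : ¬ ∃ ν : Measure X, IsProbabilityMeasure ν ∧ ν ≪ μ ∧ ν.map T = ν)
    (L : ℕ) (A : Fin L → Set X) (hmeas : ∀ i, MeasurableSet (A i))
    (hpos : ∀ i, 0 < μ (A i)) (hfin : ∀ i, μ (A i) < ⊤) :
    ∃ n : ℕ → ℕ, StrictMono n ∧
      ∀ a b : Fin L, ∀ ε : ℝ≥0∞, 0 < ε → ∃ M : ℕ, ∀ l j : ℕ, l < j → M ≤ j - l →
        μ (A a ∩ T^[n j - n l] ⁻¹' A b) < ε := by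
  let B : Set X := ⋃ i, A i
  have hB : MeasurableSet B := MeasurableSet.iUnion hmeas
  have hBfin : μ B ≠ ∞ := by
    refine ((measure_iUnion_fintype_le μ A).trans_lt ?_).ne
    exact ENNReal.sum_lt_top.2 fun i _ ↦ hfin i
  choose next hgt hlt using fun j m : ℕ ↦ exists_gt_forall_le_measureReal_lt hT hnoacip hB hBfin
    (Nat.one_div_pos_of_nat (α := ℝ) (n := j)) m
  let n : ℕ → ℕ := fun k ↦ Nat.rec 0 next k
  have hn : StrictMono n := strictMono_nat_of_lt_succ fun j ↦ hgt j (n j)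
  refine ⟨n, hn, fun a b ε hε ↦ ?_⟩
  obtain ⟨M, hM⟩ := ENNReal.exists_inv_nat_lt hε.ne'
  refine ⟨M, fun l j hlj hMj ↦ ?_⟩
  obtain ⟨j, rfl⟩ : ∃ i, j = i + 1 := ⟨j - 1, by lia⟩
  have hsmall := hlt j (n j) (n l) (hn.monotone (by lia))
  calc μ (A a ∩ T^[n (j + 1) - n l] ⁻¹' A b)
      ≤ μ (B ∩ T^[n (j + 1) - n l] ⁻¹' B) :=
        measure_mono (Set.inter_subset_inter (Set.subset_iUnion A a)
          (Set.preimage_mono (Set.subset_iUnion A b)))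
    _ ≤ ENNReal.ofReal (1 / ((j : ℝ) + 1)) :=
        (ENNReal.le_ofReal_iff_toReal_le (measure_ne_top_of_subset Set.inter_subset_left hBfin)
          (by positivity)).2 hsmall.le
    _ = ((j + 1 : ℕ) : ℝ≥0∞)⁻¹ := by
        rw [one_div, ENNReal.ofReal_inv_of_pos (by positivity), ← Nat.cast_succ,
          ENNReal.ofReal_natCast]
    _ ≤ (M : ℝ≥0∞)⁻¹ := ENNReal.inv_le_inv.2 (by exact_mod_cast (by lia : M ≤ j + 1))
    _ < ε := hM
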